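/- Let X_1, …, X_m form a Markov chain on a tree G = (M, E). Then for every proper subset A of M containing no two vertices joined by an edge of E, X_A is conditionally independent of X_{M \ (A ∪ N(A))} given X_{N(A)}, i.e., I(X_A ∧ X_{M \ (A ∪ N(A))} | X_{N(A)}) = 0, where N(A) = (∪_{i∈A} N(i)) \ A is the neighborhood of A. -/

import Mathlib

open Classical
open scoped BigOperators

noncomputable section

namespace MCT

variable {m : ℕ}

/-- Marginal pmf of the coordinates in `A`. -/
def marg (𝒳 : Fin m → Type) [∀ i, Fintype (𝒳 i)]
    (p : (∀ i, 𝒳 i) → ℝ) (A : Finset (Fin m)) (y : (i : A) → 𝒳 i.1) : ℝ :=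
  ∑ x : (i : Fin m) → 𝒳 i, if ∀ i : A, x i.1 = y i then p x else 0

/-- Shannon entropy (base 2) of the collection `X_A`. -/
def ent (𝒳 : Fin m → Type) [∀ i, Fintype (𝒳 i)]
    (p : (∀ i, 𝒳 i) → ℝ) (A : Finset (Fin m)) : ℝ :=
  -∑ y : (i : A) → 𝒳 i.1, marg 𝒳 p A y * Real.logb 2 (marg 𝒳 p A y)

/-- Mutual information I(X_A ∧ X_B). -/
def mutI (𝒳 : Fin m → Type) [∀ i, Fintype (𝒳 i)]
    (p : (∀ i, 𝒳 i) → ℝ) (A B : Finset (Fin m)) : ℝ :=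
  ent 𝒳 p A + ent 𝒳 p B - ent 𝒳 p (A ∪ B)

/-- Conditional mutual information I(X_A ∧ X_B | X_S). -/
def cmi (𝒳 : Fin m → Type) [∀ i, Fintype (𝒳 i)]
    (p : (∀ i, 𝒳 i) → ℝ) (A B S : Finset (Fin m)) : ℝ :=
  ent 𝒳 p (A ∪ S) + ent 𝒳 p (B ∪ S) - ent 𝒳 p (A ∪ B ∪ S) - ent 𝒳 p S

/-- `side G i j` = B(i←j): vertices connected to `j` by a path containing edge (i,j),
equivalently the vertices on `i`'s side once edge (i,j) is removed. -/
def side {V : Type*} [Fintype V] (G : SimpleGraph V) (i j : V) : Finset V :=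
  Finset.univ.filter fun k => (G.deleteEdges {s(i, j)}).Reachable k i

/-- Markov chain on a tree: for each edge (i,j), X_j ⊥ X_{B(i←j)\{i}} | X_i. -/
def IsMCT (𝒳 : Fin m → Type) [∀ i, Fintype (𝒳 i)] (G : SimpleGraph (Fin m))
    (p : (∀ i, 𝒳 i) → ℝ) : Prop :=
  ∀ i j : Fin m, G.Adj i j → cmi 𝒳 p {j} ((side G i j).erase i) {i} = 0

/-- A partition of {1,…,m} into nonempty pairwise disjoint atoms covering everything. -/
def IsPartition (π : Finset (Finset (Fin m))) : Prop :=
  (∀ a ∈ π, a.Nonempty) ∧ ((π : Set (Finset (Fin m))).PairwiseDisjoint id) ∧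
    π.sup id = Finset.univ

/-- I(π) = (1/(|π|−1))·[Σ_{a∈π} H(X_a) − H(X_M)]. -/
def cI (𝒳 : Fin m → Type) [∀ i, Fintype (𝒳 i)]
    (p : (∀ i, 𝒳 i) → ℝ) (π : Finset (Finset (Fin m))) : ℝ :=
  ((π.card : ℝ) - 1)⁻¹ * ((∑ a ∈ π, ent 𝒳 p a) - ent 𝒳 p Finset.univ)

/-- Shared information: minimum of I(π) over partitions with at least two atoms. -/
def SI (𝒳 : Fin m → Type) [∀ i, Fintype (𝒳 i)] (p : (∀ i, 𝒳 i) → ℝ) : ℝ :=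
  sInf {r | ∃ π : Finset (Finset (Fin m)), IsPartition π ∧ 2 ≤ π.card ∧ r = cI 𝒳 p π}


/-- Neighborhood of a vertex. -/
def nbr {V : Type*} [Fintype V] (G : SimpleGraph V) (i : V) : Finset V :=
  Finset.univ.filter fun j => G.Adj i j

/-- Neighborhood of a set: N(A) = (∪_{i∈A} N(i)) \ A. -/
def nbrSet {V : Type*} [Fintype V] [DecidableEq V] (G : SimpleGraph V) (A : Finset V) :
    Finset V :=
  (A.biUnion fun i => nbr G i) \ A

section Entropy

variable (𝒳 : Fin m → Type) [∀ i, Fintype (𝒳 i)] (p : (∀ i, 𝒳 i) → ℝ)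

/-- The marginal on `A`, evaluated at the restriction of a full configuration. -/
def margAt (A : Finset (Fin m)) (x : ∀ i, 𝒳 i) : ℝ :=
  marg 𝒳 p A fun i => x i.1

theorem margAt_eq (A : Finset (Fin m)) (x : ∀ i, 𝒳 i) :
    margAt 𝒳 p A x = ∑ z, if ∀ i ∈ A, z i = x i then p z else 0 := by
  simp [margAt, marg]

theorem margAt_congr {A : Finset (Fin m)} {x y : ∀ i, 𝒳 i} (h : ∀ i ∈ A, x i = y i) :
    margAt 𝒳 p A x = margAt 𝒳 p A y := by
  unfold margAt
  congr 1
  funext i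
  exact h i.1 i.2

theorem ent_eq_sum_margAt (A : Finset (Fin m)) :
    ent 𝒳 p A = -∑ x, p x * Real.logb 2 (margAt 𝒳 p A x) := by
  unfold ent margAt
  congr 1
  calc ∑ y : (i : A) → 𝒳 i.1, marg 𝒳 p A y * Real.logb 2 (marg 𝒳 p A y)
      = ∑ y : (i : A) → 𝒳 i.1, ∑ x : (i : Fin m) → 𝒳 i,
          if y = (fun i : A => x i.1) then p x * Real.logb 2 (marg 𝒳 p A y) else 0 := by
        refine Finset.sum_congr rfl fun y _ => ?_
        conv_lhs => enter [1]; unfold marg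
        rw [Finset.sum_mul]
        refine Finset.sum_congr rfl fun x _ => ?_
        have : (∀ i : A, x i.1 = y i) ↔ y = fun i : A => x i.1 := by
          rw [funext_iff]
          exact forall_congr' fun i => eq_comm
        simp only [this, ite_mul, zero_mul]
    _ = _ := by
        rw [Finset.sum_comm]
        refine Finset.sum_congr rfl fun x _ => ?_
        rw [Finset.sum_ite_eq' Finset.univ]
        simp

variable {p}

theorem margAt_nonneg (hp0 : ∀ x, 0 ≤ p x) (A : Finset (Fin m)) (x : ∀ i, 𝒳 i) :
    0 ≤ margAt 𝒳 p A x := by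
  rw [margAt_eq]
  refine Finset.sum_nonneg fun z _ => ?_
  split_ifs
  exacts [hp0 z, le_rfl]

theorem le_margAt (hp0 : ∀ x, 0 ≤ p x) (A : Finset (Fin m)) (x : ∀ i, 𝒳 i) :
    p x ≤ margAt 𝒳 p A x := by
  rw [margAt_eq]
  have h := Finset.single_le_sum (f := fun z => if ∀ i ∈ A, z i = x i then p z else 0)
    (fun z _ => by split_ifs; exacts [hp0 z, le_rfl]) (Finset.mem_univ x)
  simpa using h

theorem sum_div_margAt_le_one (P Q : Finset (Fin m))
    (y z : ∀ i, 𝒳 i) :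
    (∑ x, if (∀ i ∈ P, y i = x i) ∧ (∀ i ∈ Q, z i = x i) then p x / margAt 𝒳 p (P ∪ Q) x else 0)
      ≤ if ∀ i ∈ P ∩ Q, z i = y i then 1 else 0 := by
  by_cases hex : ∃ x₀ : ∀ i, 𝒳 i, (∀ i ∈ P, y i = x₀ i) ∧ (∀ i ∈ Q, z i = x₀ i)
  · obtain ⟨x₀, hy, hz⟩ := hex
    rw [if_pos fun i hi => by
      rw [Finset.mem_inter] at hi
      rw [hy i hi.1, hz i hi.2]]
    calc _ = ∑ x, (if ∀ i ∈ P ∪ Q, x i = x₀ i then p x else 0) / margAt 𝒳 p (P ∪ Q) x₀ := by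
          refine Finset.sum_congr rfl fun x _ => ?_
          have hiff : ((∀ i ∈ P, y i = x i) ∧ (∀ i ∈ Q, z i = x i)) ↔
              ∀ i ∈ P ∪ Q, x i = x₀ i := by
            simp only [Finset.mem_union]
            constructor
            · rintro ⟨h1, h2⟩ i (hi | hi)
              · rw [← h1 i hi, hy i hi]
              · rw [← h2 i hi, hz i hi]
            · intro h
              exact ⟨fun i hi => by rw [hy i hi, h i (.inl hi)],
                fun i hi => by rw [hz i hi, h i (.inr hi)]⟩
          by_cases hx : ∀ i ∈ P ∪ Q, x i = x₀ i
          · rw [if_pos (hiff.2 hx), if_pos hx, margAt_congr 𝒳 p hx]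
          · rw [if_neg (fun h => hx (hiff.1 h)), if_neg hx, zero_div]
      _ = margAt 𝒳 p (P ∪ Q) x₀ / margAt 𝒳 p (P ∪ Q) x₀ := by
          rw [← Finset.sum_div, ← margAt_eq]
      _ ≤ 1 := div_self_le_one _
  · rw [Finset.sum_eq_zero fun x _ => if_neg fun h => hex ⟨x, h⟩]
    split_ifs <;> norm_num

theorem sum_mul_margAt_div_le_one (hp0 : ∀ x, 0 ≤ p x) (hp1 : ∑ x, p x = 1)
    (P Q : Finset (Fin m)) :
    ∑ x, p x * (margAt 𝒳 p P x * margAt 𝒳 p Q x /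
      (margAt 𝒳 p (P ∪ Q) x * margAt 𝒳 p (P ∩ Q) x)) ≤ 1 := by
  calc _ = ∑ x, ∑ y, ∑ z, p y * p z / margAt 𝒳 p (P ∩ Q) y *
        (if (∀ i ∈ P, y i = x i) ∧ (∀ i ∈ Q, z i = x i) then
          p x / margAt 𝒳 p (P ∪ Q) x else 0) := by
        refine Finset.sum_congr rfl fun x _ => ?_
        rw [show p x * (margAt 𝒳 p P x * margAt 𝒳 p Q x /
          (margAt 𝒳 p (P ∪ Q) x * margAt 𝒳 p (P ∩ Q) x)) =
          margAt 𝒳 p P x * margAt 𝒳 p Q x *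
            (p x / margAt 𝒳 p (P ∪ Q) x / margAt 𝒳 p (P ∩ Q) x) by ring,
          margAt_eq 𝒳 p P, margAt_eq 𝒳 p Q, Finset.sum_mul_sum, Finset.sum_mul]
        refine Finset.sum_congr rfl fun y _ => ?_
        rw [Finset.sum_mul]
        refine Finset.sum_congr rfl fun z _ => ?_
        by_cases hy : ∀ i ∈ P, y i = x i
        · by_cases hz : ∀ i ∈ Q, z i = x i
          · rw [if_pos hy, if_pos hz, if_pos ⟨hy, hz⟩, margAt_congr 𝒳 p (A := P ∩ Q)
              (x := y) (y := x) fun i hi => hy i (Finset.mem_inter.1 hi).1]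
            ring
          · simp [hz]
        · simp [hy]
    _ = ∑ y, ∑ z, p y * p z / margAt 𝒳 p (P ∩ Q) y *
        ∑ x, (if (∀ i ∈ P, y i = x i) ∧ (∀ i ∈ Q, z i = x i) then
          p x / margAt 𝒳 p (P ∪ Q) x else 0) := by
        rw [Finset.sum_comm]
        refine Finset.sum_congr rfl fun y _ => ?_
        rw [Finset.sum_comm]
        simp only [Finset.mul_sum]
    _ ≤ ∑ y, ∑ z, p y * p z / margAt 𝒳 p (P ∩ Q) y *
        (if ∀ i ∈ P ∩ Q, z i = y i then 1 else 0) := by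
        refine Finset.sum_le_sum fun y _ => Finset.sum_le_sum fun z _ => ?_
        exact mul_le_mul_of_nonneg_left (sum_div_margAt_le_one 𝒳 P Q y z)
          (div_nonneg (mul_nonneg (hp0 y) (hp0 z)) (margAt_nonneg 𝒳 hp0 _ _))
    _ = ∑ y, p y * (margAt 𝒳 p (P ∩ Q) y / margAt 𝒳 p (P ∩ Q) y) := by
        refine Finset.sum_congr rfl fun y _ => ?_
        conv_rhs => rw [margAt_eq 𝒳 p (P ∩ Q) y, Finset.sum_div, ← margAt_eq, Finset.mul_sum]
        refine Finset.sum_congr rfl fun z _ => ?_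
        split_ifs <;> ring
    _ ≤ ∑ y, p y := Finset.sum_le_sum fun y _ =>
        mul_le_of_le_one_right (hp0 y) (div_self_le_one _)
    _ = 1 := hp1

/-- Submodularity of Shannon entropy. -/
theorem ent_union_add_ent_inter_le (hp0 : ∀ x, 0 ≤ p x) (hp1 : ∑ x, p x = 1)
    (P Q : Finset (Fin m)) :
    ent 𝒳 p (P ∪ Q) + ent 𝒳 p (P ∩ Q) ≤ ent 𝒳 p P + ent 𝒳 p Q := by
  have key : ∀ x, p x * (Real.logb 2 (margAt 𝒳 p P x) + Real.logb 2 (margAt 𝒳 p Q x)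
      - Real.logb 2 (margAt 𝒳 p (P ∪ Q) x) - Real.logb 2 (margAt 𝒳 p (P ∩ Q) x)) ≤
      (p x * (margAt 𝒳 p P x * margAt 𝒳 p Q x /
        (margAt 𝒳 p (P ∪ Q) x * margAt 𝒳 p (P ∩ Q) x)) - p x) / Real.log 2 := by
    intro x
    rcases (hp0 x).eq_or_lt with h | h
    · simp [← h]
    have hpos : ∀ A, 0 < margAt 𝒳 p A x := fun A => h.trans_le (le_margAt 𝒳 hp0 A x)
    have hlog := Real.log_le_sub_one_of_pos
      (div_pos (mul_pos (hpos P) (hpos Q)) (mul_pos (hpos (P ∪ Q)) (hpos (P ∩ Q))))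
    rw [Real.log_div (mul_pos (hpos P) (hpos Q)).ne' (mul_pos (hpos _) (hpos _)).ne',
      Real.log_mul (hpos _).ne' (hpos _).ne', Real.log_mul (hpos _).ne' (hpos _).ne'] at hlog
    have h2 : 0 < Real.log 2 := Real.log_pos one_lt_two
    rw [le_div_iff₀ h2]
    have := mul_le_mul_of_nonneg_left hlog h.le
    simp only [Real.logb]
    field_simp at this ⊢
    linarith
  have hsum := Finset.sum_le_sum fun x (_ : x ∈ Finset.univ) => key x
  rw [← Finset.sum_div, Finset.sum_sub_distrib, hp1] at hsum
  have hle := hsum.trans (div_nonpos_of_nonpos_of_nonneg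
    (sub_nonpos.2 (sum_mul_margAt_div_le_one 𝒳 hp0 hp1 P Q)) (Real.log_pos one_lt_two).le)
  simp only [mul_sub, mul_add, Finset.sum_sub_distrib, Finset.sum_add_distrib] at hle
  simp only [ent_eq_sum_margAt]
  linarith

end Entropy

section Submodular

variable {V : Type*} [DecidableEq V] {h : Finset V → ℝ}

theorem insert_sub_antitone (hsub : ∀ P Q, h (P ∪ Q) + h (P ∩ Q) ≤ h P + h Q)
    {S T : Finset V} {v : V} (hST : S ⊆ T) (hv : v ∉ T) :
    h (insert v T) - h T ≤ h (insert v S) - h S := by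
  have := hsub (insert v S) T
  rw [Finset.insert_union, Finset.union_eq_right.2 hST, Finset.insert_inter_of_notMem hv,
    Finset.inter_eq_left.2 hST] at this
  linarith

theorem insert_sub_eq_of_sandwich (hsub : ∀ P Q, h (P ∪ Q) + h (P ∩ Q) ≤ h P + h Q)
    {R S T : Finset V} {v : V} (hRS : R ⊆ S) (hST : S ⊆ T) (hv : v ∉ T)
    (hRT : h (insert v T) - h T = h (insert v R) - h R) :
    h (insert v S) - h S = h (insert v R) - h R :=
  le_antisymm (insert_sub_antitone hsub hRS fun hS => hv (hST hS))
    (hRT ▸ insert_sub_antitone hsub hST hv)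

end Submodular

section Tree

variable {V : Type*} {G : SimpleGraph V}

theorem exists_adj_dist_add_one_eq (hG : G.Connected) {a w : V} (hw : w ≠ a) :
    ∃ u, G.Adj w u ∧ G.dist a u + 1 = G.dist a w := by
  obtain ⟨q, hq⟩ := hG.exists_walk_length_eq_dist w a
  cases q with
  | nil => exact absurd rfl hw
  | @cons _ u _ hadj q =>
    refine ⟨u, hadj, ?_⟩
    rw [SimpleGraph.Walk.length_cons, SimpleGraph.dist_comm] at hq
    have h1 : G.dist a u ≤ q.length := SimpleGraph.dist_comm (G := G) ▸ SimpleGraph.dist_le q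
    have h2 : G.dist a w ≤ G.dist a u + G.dist u w := hG.dist_triangle
    rw [SimpleGraph.dist_eq_one_iff_adj.2 hadj.symm] at h2
    omega

theorem reachable_deleteEdges_of_dist_le (hG : G.Connected) {a i v w : V} (hw : w ≠ v)
    (hd : G.dist a w ≤ G.dist a v) : (G.deleteEdges {s(i, v)}).Reachable w a := by
  induction hn : G.dist a w using Nat.strong_induction_on generalizing w with
  | _ n ih =>
    by_cases hwa : w = a
    · exact hwa ▸ SimpleGraph.Reachable.refl _
    obtain ⟨u, hadj, hu⟩ := exists_adj_dist_add_one_eq hG hwa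
    have huv : u ≠ v := by rintro rfl; omega
    refine SimpleGraph.Reachable.trans (SimpleGraph.Adj.reachable ?_)
      (ih _ (by omega) huv (by omega) rfl)
    rw [SimpleGraph.deleteEdges_adj]
    refine ⟨hadj, ?_⟩
    simp only [Set.mem_singleton_iff, Sym2.eq_iff, not_or]
    exact ⟨fun h => huv h.2, fun h => hw h.1⟩

variable [Fintype V]

theorem mem_side_of_dist_le (hG : G.Connected) {a i v w : V} (hi : G.dist a i < G.dist a v)
    (hw : w ≠ v) (hd : G.dist a w ≤ G.dist a v) : w ∈ side G i v := by
  simp only [side, Finset.mem_filter, Finset.mem_univ, true_and]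
  refine (reachable_deleteEdges_of_dist_le hG hw hd).trans
    (reachable_deleteEdges_of_dist_le hG ?_ hi.le).symm
  rintro rfl
  exact lt_irrefl _ hi

theorem notMem_side (hG : G.IsTree) {i v : V} (hadj : G.Adj i v) : v ∉ side G i v := by
  simp only [side, Finset.mem_filter, Finset.mem_univ, true_and]
  intro hr
  exact SimpleGraph.isBridge_iff.1
    (SimpleGraph.isAcyclic_iff_forall_adj_isBridge.1 hG.isAcyclic hadj) hr.symm

variable [DecidableEq V] {h : Finset V → ℝ}

/-- Local Markov property at a single vertex, for a set closed towards that vertex. -/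
theorem sub_erase_eq_of_closed (hsub : ∀ P Q, h (P ∪ Q) + h (P ∩ Q) ≤ h P + h Q)
    (hG : G.IsTree)
    (hedge : ∀ i j, G.Adj i j → h (insert j (side G i j)) - h (side G i j) =
      h (insert j {i}) - h {i})
    (a : V) (S : Finset V) (haS : insert a (nbr G a) ⊆ S)
    (hS : ∀ v ∈ S, ∀ w, G.dist a w < G.dist a v → w ∈ S) :
    h S - h (S.erase a) = h (insert a (nbr G a)) - h (nbr G a) := by
  have ha : a ∉ nbr G a := by simp [nbr]
  induction hn : S.card using Nat.strong_induction_on generalizing S with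
  | _ n ih =>
    by_cases hEq : S = insert a (nbr G a)
    · rw [hEq, Finset.erase_insert ha]
    have hne : (S \ insert a (nbr G a)).Nonempty := by
      rw [Finset.sdiff_nonempty]
      exact fun hsub' => hEq (hsub'.antisymm haS)
    obtain ⟨v, hv, hmax⟩ := Finset.exists_max_image _ (G.dist a) hne
    rw [Finset.mem_sdiff] at hv
    obtain ⟨hvS, hv⟩ := hv
    have hva : v ≠ a := fun e => hv (e ▸ Finset.mem_insert_self _ _)
    have hadj : ¬ G.Adj a v := fun e => hv (Finset.mem_insert_of_mem (by simpa [nbr] using e))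
    have hdv : 1 < G.dist a v := hG.1.one_lt_dist_of_ne_of_not_adj hva.symm hadj
    have hmaxS : ∀ w ∈ S, G.dist a w ≤ G.dist a v := by
      intro w hw
      by_cases hwI : w ∈ insert a (nbr G a)
      · rcases Finset.mem_insert.1 hwI with rfl | hwN
        · simp
        · have : G.Adj a w := by simpa [nbr] using hwN
          rw [SimpleGraph.dist_eq_one_iff_adj.2 this]
          exact hdv.le
      · exact hmax w (Finset.mem_sdiff.2 ⟨hw, hwI⟩)
    obtain ⟨i, hvi, hi⟩ := exists_adj_dist_add_one_eq hG.1 hva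
    have hia : i ≠ a := by rintro rfl; simp at hi; omega
    have hiS : i ∈ S := hS v hvS i (by omega)
    have hside : S.erase v ⊆ side G i v := fun w hw =>
      mem_side_of_dist_le hG.1 (by omega) (Finset.ne_of_mem_erase hw)
        (hmaxS w (Finset.mem_of_mem_erase hw))
    have hvside := notMem_side hG hvi.symm
    have h1 := insert_sub_eq_of_sandwich hsub (R := {i}) (S := S.erase v) (v := v)
      (by simp [hiS, hvi.ne']) hside hvside (hedge i v hvi.symm)
    have h2 := insert_sub_eq_of_sandwich hsub (R := {i}) (S := (S.erase v).erase a) (v := v)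
      (by simp [hiS, hvi.ne', hia]) ((Finset.erase_subset _ _).trans hside) hvside
      (hedge i v hvi.symm)
    have h3 := ih (S.erase v).card (hn ▸ Finset.card_erase_lt_of_mem hvS) (S.erase v)
      (fun w hw => Finset.mem_erase.2 ⟨fun e => hv (e ▸ hw), haS hw⟩)
      (fun w hw u hu => Finset.mem_erase.2 ⟨fun e => by
        have := hmaxS w (Finset.mem_of_mem_erase hw)
        rw [e] at hu
        omega, hS w (Finset.mem_of_mem_erase hw) u hu⟩) rfl
    rw [Finset.insert_erase hvS] at h1
    rw [Finset.erase_right_comm, Finset.insert_erase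
      (Finset.mem_erase.2 ⟨hva, hvS⟩)] at h2
    rw [Finset.erase_right_comm] at h3
    linarith

theorem insert_sub_eq_nbr (hsub : ∀ P Q, h (P ∪ Q) + h (P ∩ Q) ≤ h P + h Q)
    (hG : G.IsTree)
    (hedge : ∀ i j, G.Adj i j → h (insert j (side G i j)) - h (side G i j) =
      h (insert j {i}) - h {i})
    {a : V} {S : Finset V} (hS : nbr G a ⊆ S) (ha : a ∉ S) :
    h (insert a S) - h S = h (insert a (nbr G a)) - h (nbr G a) := by
  refine insert_sub_eq_of_sandwich hsub (T := Finset.univ.erase a) hS ?_ (by simp) ?_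
  · exact fun w hw => Finset.mem_erase.2 ⟨fun e => ha (e ▸ hw), Finset.mem_univ _⟩
  · rw [Finset.insert_erase (Finset.mem_univ a)]
    exact sub_erase_eq_of_closed hsub hG hedge a _ (Finset.subset_univ _)
      fun _ _ _ _ => Finset.mem_univ _

theorem union_sub_eq_sum_nbr (hsub : ∀ P Q, h (P ∪ Q) + h (P ∩ Q) ≤ h P + h Q)
    (hG : G.IsTree)
    (hedge : ∀ i j, G.Adj i j → h (insert j (side G i j)) - h (side G i j) =
      h (insert j {i}) - h {i})
    (A S : Finset V) (hS : ∀ a ∈ A, nbr G a ⊆ S) (hAS : Disjoint A S) :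
    h (A ∪ S) - h S = ∑ a ∈ A, (h (insert a (nbr G a)) - h (nbr G a)) := by
  induction A using Finset.induction_on with
  | empty => simp
  | insert a A ha ih =>
    rw [Finset.disjoint_insert_left] at hAS
    have h1 := ih (fun b hb => hS b (Finset.mem_insert_of_mem hb)) hAS.2
    have h2 := insert_sub_eq_nbr hsub hG hedge (a := a) (S := A ∪ S)
      ((hS a (Finset.mem_insert_self _ _)).trans Finset.subset_union_right)
      (by simp [ha, hAS.1])
    rw [Finset.sum_insert ha, Finset.insert_union]
    linarith

end Tree

theorem IsMCT.ent_insert_side_sub {𝒳 : Fin m → Type} [∀ i, Fintype (𝒳 i)]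
    {G : SimpleGraph (Fin m)} {p : (∀ i, 𝒳 i) → ℝ} (hMCT : IsMCT 𝒳 G p) {i j : Fin m}
    (hadj : G.Adj i j) :
    ent 𝒳 p (insert j (side G i j)) - ent 𝒳 p (side G i j) =
      ent 𝒳 p (insert j {i}) - ent 𝒳 p {i} := by
  have hi : i ∈ side G i j := by simp [side]
  have hs : (side G i j).erase i ∪ {i} = side G i j := by
    rw [Finset.union_comm, ← Finset.insert_eq, Finset.insert_erase hi]
  have h := hMCT i j hadj
  rw [cmi, Finset.union_assoc, hs, ← Finset.insert_eq, ← Finset.insert_eq] at h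
  linarith

/-- local Markov property for independent sets. For an MCT and any proper
subset A of M with no edge joining two of its vertices,
I(X_A ∧ X_{M∖(A∪N(A))} | X_N(A)) = 0. -/
theorem localMarkov_set
    {m : ℕ} (hm : 2 ≤ m) (𝒳 : Fin m → Type) [∀ i, Fintype (𝒳 i)]
    (p : (∀ i, 𝒳 i) → ℝ) (hp0 : ∀ x, 0 ≤ p x) (hp1 : ∑ x, p x = 1)
    (G : SimpleGraph (Fin m)) (hG : G.IsTree) (hMCT : IsMCT 𝒳 G p)
    (A : Finset (Fin m)) (hA : A ⊂ Finset.univ)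
    (hind : ∀ i ∈ A, ∀ j ∈ A, ¬ G.Adj i j) :
    cmi 𝒳 p A (Finset.univ \ (A ∪ nbrSet G A)) (nbrSet G A) = 0 := by
  have hS : ∀ a ∈ A, nbr G a ⊆ nbrSet G A := by
    intro a ha w hw
    refine Finset.mem_sdiff.2 ⟨Finset.mem_biUnion.2 ⟨a, ha, hw⟩, fun hwA => ?_⟩
    exact hind a ha w hwA (by simpa [nbr] using hw)
  have hdisj : Disjoint A (nbrSet G A) := Finset.disjoint_sdiff
  have hdisj' : Disjoint A (Finset.univ \ (A ∪ nbrSet G A)) :=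
    Finset.disjoint_sdiff.mono_left Finset.subset_union_left
  have hsub := ent_union_add_ent_inter_le 𝒳 hp0 hp1
  have hedge := fun i j (hij : G.Adj i j) => hMCT.ent_insert_side_sub hij
  have h1 := union_sub_eq_sum_nbr hsub hG hedge A _ hS hdisj
  have h2 := union_sub_eq_sum_nbr hsub hG hedge A
    ((Finset.univ \ (A ∪ nbrSet G A)) ∪ nbrSet G A)
    (fun a ha => (hS a ha).trans Finset.subset_union_right)
    (Finset.disjoint_union_right.2 ⟨hdisj', hdisj⟩)
  rw [cmi, Finset.union_assoc]
  linarith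

end MCT
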